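/- There exists exactly one function F : (−1,∞) → (0,∞) satisfying: (i) F(0) = 1; (ii) F is log-convex; (iii) 1/F(s) = 1/F(s+1) − F(s+1) for all s > −1; namely the Mellin transform F(s) = ∫₀¹ t^s dμ(t) of the fixed point measure μ. -/

import Mathlib

open MeasureTheory Set

/-- The fixed point sequence. -/
noncomputable def fpSeq : ℕ → ℝ
  | 0 => 1
  | n + 1 => (-1 + Real.sqrt (1 + 4 * fpSeq n ^ 2)) / (2 * fpSeq n)

/-- The Mellin transform of `μ` restricted to real arguments. -/
noncomputable def mellinReal (μ : Measure ℝ) (s : ℝ) : ℝ :=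
  ∫ t in Set.Icc (0:ℝ) 1, t ^ s ∂μ

/-- Positive log-convex solutions on `(-1, ∞)` of `1 / F s = 1 / F (s + 1) - F (s + 1)`
normalized by `F 0 = 1`. -/
structure IsLogConvexSolution (F : ℝ → ℝ) : Prop where
  pos : ∀ s : ℝ, -1 < s → 0 < F s
  map_zero : F 0 = 1
  logConvex : ConvexOn ℝ (Set.Ioi (-1 : ℝ)) (fun s => Real.log (F s))
  recurrence : ∀ s : ℝ, -1 < s → 1 / F s = 1 / F (s + 1) - F (s + 1)

namespace IsLogConvexSolution

variable {F G : ℝ → ℝ} {s : ℝ}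

theorem map_add_one_lt_one (hF : IsLogConvexSolution F) (hs : -1 < s) : F (s + 1) < 1 := by
  have h1 := hF.pos (s + 1) (by linarith)
  have h2 : 0 < 1 / F (s + 1) - F (s + 1) :=
    hF.recurrence s hs ▸ one_div_pos.2 (hF.pos s hs)
  have h3 : F (s + 1) * F (s + 1) < 1 := by
    rw [← lt_div_iff₀ h1]; linarith
  nlinarith

theorem eq_of_eq_add_one (hF : IsLogConvexSolution F) (hG : IsLogConvexSolution G) (hs : -1 < s)
    (h : F (s + 1) = G (s + 1)) : F s = G s := by
  have h1 := hF.recurrence s hs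
  rw [h, ← hG.recurrence s hs] at h1
  simpa using h1

theorem eq_add_one_of_eq (hF : IsLogConvexSolution F) (hG : IsLogConvexSolution G) (hs : -1 < s)
    (h : F s = G s) : F (s + 1) = G (s + 1) := by
  have h1 := hF.recurrence s hs
  rw [h, hG.recurrence s hs] at h1
  have hf := hF.pos (s + 1) (by linarith)
  have hg := hG.pos (s + 1) (by linarith)
  rcases lt_trichotomy (F (s + 1)) (G (s + 1)) with hlt | heq | hlt
  · linarith [one_div_lt_one_div_of_lt hf hlt]
  · exact heq
  · linarith [one_div_lt_one_div_of_lt hg hlt]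

theorem eq_natCast (hF : IsLogConvexSolution F) (hG : IsLogConvexSolution G) (n : ℕ) :
    F n = G n := by
  induction n with
  | zero => simp [hF.map_zero, hG.map_zero]
  | succ n ih =>
    push_cast
    exact hF.eq_add_one_of_eq hG (by linarith [(Nat.cast_nonneg n : (0 : ℝ) ≤ n)]) ih

/-- In terms of `F⁻²` the recurrence becomes a perturbed translation by `2`. -/
theorem inv_sq_recurrence (hF : IsLogConvexSolution F) (hs : -1 < s) :
    1 / F s ^ 2 = 1 / F (s + 1) ^ 2 - 2 + F (s + 1) ^ 2 := by
  have h1 := hF.pos (s + 1) (by linarith)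
  rw [← one_div_pow, hF.recurrence s hs]
  field_simp
  ring

theorem abs_inv_sq_sub_le (hF : IsLogConvexSolution F) (hG : IsLogConvexSolution G)
    (hs : -1 < s) :
    |1 / F s ^ 2 - 1 / G s ^ 2| ≤ |1 / F (s + 1) ^ 2 - 1 / G (s + 1) ^ 2| := by
  have hf := hF.pos (s + 1) (by linarith)
  have hg := hG.pos (s + 1) (by linarith)
  have hf1 := hF.map_add_one_lt_one hs
  have hg1 := hG.map_add_one_lt_one hs
  have key : 1 / F s ^ 2 - 1 / G s ^ 2 =
      (1 / F (s + 1) ^ 2 - 1 / G (s + 1) ^ 2) * (1 - F (s + 1) ^ 2 * G (s + 1) ^ 2) := by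
    rw [hF.inv_sq_recurrence hs, hG.inv_sq_recurrence hs]
    field_simp
    ring
  rw [key, abs_mul]
  refine mul_le_of_le_one_right (abs_nonneg _) (abs_le.2 ⟨?_, ?_⟩)
  · have := mul_le_one₀ (pow_le_one₀ hf.le hf1.le (n := 2)) (by positivity)
      (pow_le_one₀ hg.le hg1.le (n := 2))
    linarith
  · have : 0 ≤ F (s + 1) ^ 2 * G (s + 1) ^ 2 := by positivity
    linarith

theorem abs_inv_sq_sub_le_add_nat (hF : IsLogConvexSolution F) (hG : IsLogConvexSolution G)
    (hs : -1 < s) (n : ℕ) :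
    |1 / F s ^ 2 - 1 / G s ^ 2| ≤ |1 / F (n + s) ^ 2 - 1 / G (n + s) ^ 2| := by
  induction n with
  | zero => simp
  | succ n ih =>
    have := hF.abs_inv_sq_sub_le hG (s := n + s) (by linarith [(Nat.cast_nonneg n : (0 : ℝ) ≤ n)])
    rw [show (n : ℝ) + s + 1 = (n + 1 : ℕ) + s by push_cast; ring] at this
    exact ih.trans this

theorem inv_sq_add_nat_le (hF : IsLogConvexSolution F) (hs : -1 < s) (n : ℕ) :
    1 / F (n + s) ^ 2 ≤ 2 * n + 1 / F s ^ 2 := by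
  induction n with
  | zero => simp
  | succ n ih =>
    have := hF.inv_sq_recurrence (s := n + s) (by linarith [(Nat.cast_nonneg n : (0 : ℝ) ≤ n)])
    rw [show (n : ℝ) + s + 1 = (n + 1 : ℕ) + s by push_cast; ring] at this
    have h2 := sq_nonneg (F ((n + 1 : ℕ) + s))
    have h3 : ((n + 1 : ℕ) : ℝ) = n + 1 := by push_cast; ring
    linarith

theorem le_inv_sq_natCast (hF : IsLogConvexSolution F) (n : ℕ) : (n : ℝ) + 1 ≤ 1 / F n ^ 2 := by
  induction n with
  | zero => simp [hF.map_zero]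
  | succ n ih =>
    have hn : (-1 : ℝ) < n := by linarith [(Nat.cast_nonneg n : (0 : ℝ) ≤ n)]
    have h1 := hF.inv_sq_recurrence hn
    have h2 := pow_le_one₀ (hF.pos (n + 1) (by linarith)).le (hF.map_add_one_lt_one hn).le (n := 2)
    push_cast
    linarith

/-- Second differences of `log F` at the integers decay quadratically. -/
theorem secondDiff_log_le (hF : IsLogConvexSolution F) (n : ℕ) (hn : 2 ≤ n) :
    Real.log (F (n + 1)) - 2 * Real.log (F n) + Real.log (F (n - 1)) ≤ 2 / ((n + 1) ^ 2 - 4) := by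
  have hn' : (2 : ℝ) ≤ n := by exact_mod_cast hn
  have ha := hF.pos (n - 1) (by linarith)
  have hb := hF.pos n (by linarith)
  have hc := hF.pos (n + 1) (by linarith)
  have hu := hF.le_inv_sq_natCast n
  have r1 := hF.inv_sq_recurrence (s := n - 1) (by linarith)
  have r2 := hF.inv_sq_recurrence (s := n) (by linarith)
  have hc1 := hF.map_add_one_lt_one (s := n) (by linarith)
  rw [sub_add_cancel] at r1
  have la : Real.log (1 / F (n - 1) ^ 2) = -2 * Real.log (F (n - 1)) := by
    simp [Real.log_pow]
  have lb : Real.log (1 / F n ^ 2) = -2 * Real.log (F n) := by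
    simp [Real.log_pow]
  have lc : Real.log (1 / F (n + 1) ^ 2) = -2 * Real.log (F (n + 1)) := by
    simp [Real.log_pow]
  set a := 1 / F (n - 1) ^ 2
  set b := 1 / F n ^ 2 with hB
  set c := 1 / F (n + 1) ^ 2 with hC
  have hbinv : F n ^ 2 = 1 / b := by rw [hB]; simp
  have hcinv : F (n + 1) ^ 2 = 1 / c := by rw [hC]; simp
  have ha0 : 0 < a := by positivity
  have hb0 : 0 < b := by positivity
  have hc0 : 0 < c := by positivity
  have hbc : b ≤ c := by
    have := pow_le_one₀ hc.le hc1.le (n := 2)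
    linarith
  have hcb : F (n + 1) ^ 2 ≤ F n ^ 2 := by
    rw [hbinv, hcinv]; exact one_div_le_one_div_of_le hb0 hbc
  have hb1 : F n ^ 2 ≤ 1 := by
    rw [hbinv, div_le_one hb0]; linarith
  have hprod : b ^ 2 - 4 ≤ c * a := by
    have h1 : b + (2 - F n ^ 2) ≤ c := by linarith
    have h2 : a = b - (2 - F n ^ 2) := by linarith
    have h3 : (b + (2 - F n ^ 2)) * a ≤ c * a := by gcongr
    rw [h2] at h3 ⊢
    nlinarith [sq_nonneg (F n)]
  have hb4 : ((n : ℝ) + 1) ^ 2 - 4 ≤ b ^ 2 - 4 := by gcongr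
  have hn4 : 0 < ((n : ℝ) + 1) ^ 2 - 4 := by nlinarith
  have hlog : Real.log (b ^ 2 / (c * a)) ≤ b ^ 2 / (c * a) - 1 :=
    Real.log_le_sub_one_of_pos (by positivity)
  rw [Real.log_div (by positivity) (by positivity), Real.log_mul hc0.ne' ha0.ne', Real.log_pow,
    la, lb, lc] at hlog
  have h4 : b ^ 2 / (c * a) - 1 ≤ 4 / ((n + 1) ^ 2 - 4) := by
    calc b ^ 2 / (c * a) - 1 ≤ b ^ 2 / (b ^ 2 - 4) - 1 := by gcongr; linarith
      _ = 4 / (b ^ 2 - 4) := by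
        have : b ^ 2 - 4 ≠ 0 := by linarith
        field_simp; ring
      _ ≤ _ := by gcongr
  have h5 : (4 : ℝ) / ((n + 1) ^ 2 - 4) = 2 * (2 / ((n + 1) ^ 2 - 4)) := by ring
  push_cast at hlog
  linarith

/-- Log-convexity pins `log F` between integers down to the second difference. -/
theorem log_sub_log_le (hF : IsLogConvexSolution F) (hG : IsLogConvexSolution G)
    (hs0 : 0 < s) (hs1 : s ≤ 1) (n : ℕ) (hn : 2 ≤ n) :
    Real.log (F (n + s)) - Real.log (G (n + s)) ≤ 2 / ((n + 1) ^ 2 - 4) := by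
  have hn' : (2 : ℝ) ≤ n := by exact_mod_cast hn
  have hD := hF.secondDiff_log_le n hn
  have e0 := hF.eq_natCast hG n
  have e1 : F (n - 1) = G (n - 1) := by
    have := hF.eq_natCast hG (n - 1)
    rwa [Nat.cast_sub (by omega), Nat.cast_one] at this
  have mem : ∀ x : ℝ, 0 ≤ x → x ∈ Set.Ioi (-1 : ℝ) := fun x hx => by
    rw [Set.mem_Ioi]; linarith
  have hup := hF.logConvex.2 (mem n (by linarith)) (mem (n + 1) (by linarith))
    (show 0 ≤ 1 - s by linarith) hs0.le (by ring)
  have hlo := hG.logConvex.2 (mem (n - 1) (by linarith)) (mem (n + s) (by linarith))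
    (show 0 ≤ s / (1 + s) by positivity) (show 0 ≤ 1 / (1 + s) by positivity)
    (by field_simp; ring)
  simp only [smul_eq_mul] at hup hlo
  rw [show (1 - s) * (n : ℝ) + s * (n + 1) = n + s by ring] at hup
  rw [show s / (1 + s) * ((n : ℝ) - 1) + 1 / (1 + s) * (n + s) = n by field_simp; ring,
    ← e0, ← e1] at hlo
  have hlo' : (1 + s) * Real.log (F n) ≤ s * Real.log (F (n - 1)) + Real.log (G (n + s)) := by
    have := mul_le_mul_of_nonneg_left hlo (show (0 : ℝ) ≤ 1 + s by linarith)
    calc _ ≤ _ := this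
      _ = _ := by field_simp
  have hpos : (0 : ℝ) ≤ 2 / ((n + 1) ^ 2 - 4) := by
    have : (0 : ℝ) < (n + 1) ^ 2 - 4 := by nlinarith
    positivity
  nlinarith [mul_le_mul_of_nonneg_left hD hs0.le]

theorem inv_sq_sub_inv_sq_le (hF : IsLogConvexSolution F) (hG : IsLogConvexSolution G)
    (hs0 : 0 < s) (hs1 : s ≤ 1) (n : ℕ) (hn : 2 ≤ n) :
    1 / G (n + s) ^ 2 - 1 / F (n + s) ^ 2 ≤
      (2 * n + 1 / G s ^ 2) * (4 / ((n + 1) ^ 2 - 4)) := by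
  have hn' : (2 : ℝ) ≤ n := by exact_mod_cast hn
  have hf := hF.pos (n + s) (by linarith)
  have hg := hG.pos (n + s) (by linarith)
  have hd := hF.log_sub_log_le hG hs0 hs1 n hn
  have hle := hG.inv_sq_add_nat_le (s := s) (by linarith) n
  have hpos : (0 : ℝ) < (n + 1) ^ 2 - 4 := by nlinarith
  have hlog : Real.log (G (n + s) ^ 2 / F (n + s) ^ 2) ≤ G (n + s) ^ 2 / F (n + s) ^ 2 - 1 :=
    Real.log_le_sub_one_of_pos (by positivity)
  rw [Real.log_div (by positivity) (by positivity), Real.log_pow, Real.log_pow] at hlog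
  push_cast at hlog
  have h1 : 1 - G (n + s) ^ 2 / F (n + s) ^ 2 ≤ 4 / ((n + 1) ^ 2 - 4) := by
    have : (4 : ℝ) / ((n + 1) ^ 2 - 4) = 2 * (2 / ((n + 1) ^ 2 - 4)) := by ring
    linarith
  calc 1 / G (n + s) ^ 2 - 1 / F (n + s) ^ 2
      = 1 / G (n + s) ^ 2 * (1 - G (n + s) ^ 2 / F (n + s) ^ 2) := by field_simp
    _ ≤ 1 / G (n + s) ^ 2 * (4 / ((n + 1) ^ 2 - 4)) := by gcongr
    _ ≤ _ := by gcongr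

theorem tendsto_linear_mul_four_div_sq_sub (C : ℝ) :
    Filter.Tendsto (fun n : ℕ => (2 * n + C) * (4 / (((n : ℝ) + 1) ^ 2 - 4))) Filter.atTop
      (nhds 0) := by
  have h1 : Filter.Tendsto (fun n : ℕ => 1 / ((n : ℝ) + 3)) Filter.atTop (nhds 0) := by
    have := (Filter.tendsto_add_atTop_iff_nat 2).2
      (tendsto_one_div_add_atTop_nhds_zero_nat (𝕜 := ℝ))
    refine this.congr fun n => ?_
    push_cast; ring
  have h2 : Filter.Tendsto (fun n : ℕ => 1 / ((n : ℝ) - 1)) Filter.atTop (nhds 0) := by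
    rw [← Filter.tendsto_add_atTop_iff_nat 2]
    refine (tendsto_one_div_add_atTop_nhds_zero_nat (𝕜 := ℝ)).congr fun n => ?_
    push_cast; ring
  have h3 : Filter.Tendsto
      (fun n : ℕ => (8 + (8 + 4 * C) * (1 / ((n : ℝ) - 1))) * (1 / ((n : ℝ) + 3)))
      Filter.atTop (nhds ((8 + (8 + 4 * C) * 0) * 0)) :=
    ((h2.const_mul _).const_add _).mul h1
  rw [mul_zero] at h3
  refine h3.congr' ?_
  filter_upwards [Filter.eventually_ge_atTop 2] with n hn
  have hn' : (2 : ℝ) ≤ n := by exact_mod_cast hn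
  have e1 : (n : ℝ) - 1 ≠ 0 := by linarith
  have e2 : (n : ℝ) + 3 ≠ 0 := by linarith
  have e3 : ((n : ℝ) + 1) ^ 2 - 4 = (n - 1) * (n + 3) := by ring
  rw [e3]
  field_simp
  ring

theorem eq_of_mem_Ioc (hF : IsLogConvexSolution F) (hG : IsLogConvexSolution G)
    (hs0 : 0 < s) (hs1 : s ≤ 1) : F s = G s := by
  have hlim := (tendsto_linear_mul_four_div_sq_sub (1 / F s ^ 2)).add
    (tendsto_linear_mul_four_div_sq_sub (1 / G s ^ 2))
  rw [add_zero] at hlim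
  have hle : |1 / F s ^ 2 - 1 / G s ^ 2| ≤ 0 := by
    refine ge_of_tendsto hlim ?_
    filter_upwards [Filter.eventually_ge_atTop 2] with n hn
    have hn' : (2 : ℝ) ≤ n := by exact_mod_cast hn
    have h1 := hF.inv_sq_sub_inv_sq_le hG hs0 hs1 n hn
    have h2 := hG.inv_sq_sub_inv_sq_le hF hs0 hs1 n hn
    have hpos : (0 : ℝ) < (n + 1) ^ 2 - 4 := by nlinarith
    have p1 : 0 ≤ (2 * n + 1 / F s ^ 2) * (4 / (((n : ℝ) + 1) ^ 2 - 4)) := by positivity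
    have p2 : 0 ≤ (2 * n + 1 / G s ^ 2) * (4 / (((n : ℝ) + 1) ^ 2 - 4)) := by positivity
    refine (hF.abs_inv_sq_sub_le_add_nat hG (by linarith) n).trans (abs_le.2 ⟨?_, ?_⟩) <;> linarith
  have h0 : 1 / F s ^ 2 = 1 / G s ^ 2 := by
    rw [← sub_eq_zero]; exact abs_nonpos_iff.1 hle
  have h1 : F s ^ 2 = G s ^ 2 := by simpa using h0
  exact (pow_left_inj₀ (hF.pos s (by linarith)).le (hG.pos s (by linarith)).le two_ne_zero).1 h1

/-- Bohr–Mollerup type uniqueness. -/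
theorem eq (hF : IsLogConvexSolution F) (hG : IsLogConvexSolution G) (hs : -1 < s) :
    F s = G s := by
  have key : ∀ n : ℕ, ∀ s : ℝ, 0 < s → s ≤ n + 1 → F s = G s := by
    intro n
    induction n with
    | zero => exact fun s h0 h1 => hF.eq_of_mem_Ioc hG h0 (by simpa using h1)
    | succ n ih =>
      intro s h0 h1
      rcases le_or_gt s 1 with h | h
      · exact hF.eq_of_mem_Ioc hG h0 h
      · have := hF.eq_add_one_of_eq hG (s := s - 1) (by linarith)
          (ih (s - 1) (by linarith) (by push_cast at h1; linarith))
        rwa [sub_add_cancel] at this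
  obtain ⟨n, hn⟩ := exists_nat_ge s
  exact hF.eq_of_eq_add_one hG hs (key n (s + 1) (by linarith) (by linarith))

end IsLogConvexSolution

theorem fpSeq_pos (n : ℕ) : 0 < fpSeq n := by
  induction n with
  | zero => simp [fpSeq]
  | succ n ih =>
    rw [fpSeq]
    have : 1 < Real.sqrt (1 + 4 * fpSeq n ^ 2) := by
      rw [Real.lt_sqrt zero_le_one]; nlinarith
    exact div_pos (by linarith) (by linarith)

theorem one_div_fpSeq_succ (n : ℕ) :
    1 / fpSeq (n + 1) = 1 / fpSeq n + fpSeq (n + 1) := by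
  have h0 := fpSeq_pos n
  have h1 := fpSeq_pos (n + 1)
  have hq : fpSeq n * fpSeq (n + 1) ^ 2 + fpSeq (n + 1) - fpSeq n = 0 := by
    rw [fpSeq]
    have hsq := Real.sq_sqrt (show 0 ≤ 1 + 4 * fpSeq n ^ 2 by positivity)
    generalize Real.sqrt (1 + 4 * fpSeq n ^ 2) = r at hsq ⊢
    field_simp
    linarith
  field_simp
  linarith

/-- The extended-real valued Mellin transform of a measure on `ℝ`. -/
noncomputable def lmellin (μ : Measure ℝ) (s : ℝ) : ENNReal :=
  ∫⁻ t, ENNReal.ofReal (t ^ s) ∂μ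

/-- Lebesgue measure on the unit interval. -/
noncomputable def unitVolume : Measure ℝ := volume.restrict (Icc 0 1)

instance : IsProbabilityMeasure unitVolume :=
  ⟨by simp [unitVolume]⟩

theorem ae_unitVolume : ∀ᵐ u ∂unitVolume, u ∈ Icc (0 : ℝ) 1 :=
  ae_restrict_mem measurableSet_Icc

theorem lintegral_unitVolume_segment_rpow {y s : ℝ} (hy : y ∈ Ico (0 : ℝ) 1) (hs : -1 < s) :
    ∫⁻ u, ENNReal.ofReal ((y + (1 - y) * u) ^ s) ∂unitVolume =
      ENNReal.ofReal ((1 - y ^ (s + 1)) / ((s + 1) * (1 - y))) := by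
  have hy' : (0 : ℝ) < 1 - y := by linarith [hy.2]
  have hint : IntervalIntegrable (fun u => (y + (1 - y) * u) ^ s) volume 0 1 := by
    have := (intervalIntegral.intervalIntegrable_rpow' (a := y) (b := 1) hs)
    have h2 := (this.comp_add_left y).comp_mul_left (c := 1 - y)
    simpa [hy'.ne'] using h2
  rw [unitVolume, ← ofReal_integral_eq_lintegral_ofReal]
  · rw [integral_Icc_eq_integral_Ioc, ← intervalIntegral.integral_of_le zero_le_one,
      intervalIntegral.integral_comp_add_mul (fun v => v ^ s) hy'.ne', integral_rpow (Or.inl hs)]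
    congr 1
    have : s + 1 ≠ 0 := by linarith
    simp
    field_simp
  · rw [← IntegrableOn, integrableOn_Icc_iff_integrableOn_Ioc]
    exact (intervalIntegrable_iff_integrableOn_Ioc_of_le zero_le_one).1 hint
  · filter_upwards [ae_restrict_mem measurableSet_Icc] with u hu
    exact Real.rpow_nonneg (add_nonneg hy.1 (mul_nonneg hy'.le hu.1)) _

theorem lmellin_unitVolume {s : ℝ} (hs : -1 < s) :
    lmellin unitVolume s = ENNReal.ofReal (1 / (s + 1)) := by
  have h := lintegral_unitVolume_segment_rpow (y := 0) (by simp) hs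
  have : s + 1 ≠ 0 := by linarith
  simpa [lmellin, Real.zero_rpow this] using h

theorem lintegral_unitVolume_segment_rpow_add_one {y s : ℝ} (hy : y ∈ Icc (0 : ℝ) 1)
    (hs : -1 < s) :
    ENNReal.ofReal (s + 2) *
        ∫⁻ u, ENNReal.ofReal ((y + (1 - y) * u) ^ (s + 1)) ∂unitVolume =
      ENNReal.ofReal (s + 1) * ∫⁻ u, ENNReal.ofReal ((y + (1 - y) * u) ^ s) ∂unitVolume +
        ENNReal.ofReal (y ^ (s + 1)) := by
  rcases hy.2.eq_or_lt with rfl | hlt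
  · simp
    rw [← ENNReal.ofReal_one, ← ENNReal.ofReal_add (by linarith) zero_le_one]
    congr 1; ring
  · have hy' : (0 : ℝ) < 1 - y := by linarith
    rw [lintegral_unitVolume_segment_rpow ⟨hy.1, hlt⟩ hs,
      lintegral_unitVolume_segment_rpow ⟨hy.1, hlt⟩ (by linarith),
      ← ENNReal.ofReal_mul (by linarith), ← ENNReal.ofReal_mul (by linarith),
      ← ENNReal.ofReal_add _ (Real.rpow_nonneg hy.1 _)]
    · congr 1
      have h1 : s + 1 ≠ 0 := by linarith
      have h2 : s + 1 + 1 ≠ 0 := by linarith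
      have h3 : y ^ (s + 1 + 1) = y ^ (s + 1) * y := Real.rpow_add_one' hy.1 h2
      rw [h3]
      field_simp
      ring
    · have : y ^ (s + 1) ≤ 1 := Real.rpow_le_one hy.1 hlt.le (by linarith)
      have h1 : 0 < s + 1 := by linarith
      exact mul_nonneg h1.le (div_nonneg (by linarith) (by positivity))

/-- The law of a uniformly random point of `[y, 1]`, where `y` has law `μ`. -/
noncomputable def segmentLaw (μ : Measure ℝ) : Measure ℝ :=
  (μ.prod unitVolume).map fun p => p.1 + (1 - p.1) * p.2

instance (μ : Measure ℝ) [IsProbabilityMeasure μ] : IsProbabilityMeasure (segmentLaw μ) :=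
  Measure.isProbabilityMeasure_map (by fun_prop)

theorem lmellin_segmentLaw (μ : Measure ℝ) [SFinite μ] (s : ℝ) :
    lmellin (segmentLaw μ) s =
      ∫⁻ y, ∫⁻ u, ENNReal.ofReal ((y + (1 - y) * u) ^ s) ∂unitVolume ∂μ := by
  rw [lmellin, segmentLaw, lintegral_map (by fun_prop) (by fun_prop),
    lintegral_prod _ (by fun_prop)]

theorem ae_segmentLaw {μ : Measure ℝ} [SFinite μ] (hμ : ∀ᵐ t ∂μ, t ∈ Icc (0 : ℝ) 1) :
    ∀ᵐ t ∂segmentLaw μ, t ∈ Icc (0 : ℝ) 1 := by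
  refine (ae_map_iff (by fun_prop) measurableSet_Icc).2 ?_
  filter_upwards [Measure.quasiMeasurePreserving_fst.ae hμ,
    Measure.quasiMeasurePreserving_snd.ae ae_unitVolume] with p h1 h2
  constructor
  · nlinarith [h1.1, h1.2, h2.1]
  · nlinarith [h1.1, h1.2, h2.1, h2.2]

theorem lmellin_segmentLaw_add_one {μ : Measure ℝ} [SFinite μ]
    (hμ : ∀ᵐ t ∂μ, t ∈ Icc (0 : ℝ) 1) {s : ℝ} (hs : -1 < s) :
    ENNReal.ofReal (s + 2) * lmellin (segmentLaw μ) (s + 1) =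
      ENNReal.ofReal (s + 1) * lmellin (segmentLaw μ) s + lmellin μ (s + 1) := by
  rw [lmellin_segmentLaw, lmellin_segmentLaw, lmellin, ← lintegral_const_mul' _ _ (by simp),
    ← lintegral_const_mul' _ _ (by simp), ← lintegral_add_right _ (by fun_prop)]
  refine lintegral_congr_ae ?_
  filter_upwards [hμ] with y hy
  exact lintegral_unitVolume_segment_rpow_add_one hy hs

theorem lmellin_mconv {μ ν : Measure ℝ} [SFinite μ] [SFinite ν]
    (hμ : ∀ᵐ t ∂μ, t ∈ Icc (0 : ℝ) 1) (hν : ∀ᵐ t ∂ν, t ∈ Icc (0 : ℝ) 1) (s : ℝ) :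
    lmellin (μ.mconv ν) s = lmellin μ s * lmellin ν s := by
  rw [lmellin, Measure.lintegral_mconv_eq_lintegral_prod (by fun_prop), lmellin, lmellin,
    ← lintegral_prod_mul (by fun_prop) (by fun_prop)]
  refine lintegral_congr_ae ?_
  filter_upwards [Measure.quasiMeasurePreserving_fst.ae hμ,
    Measure.quasiMeasurePreserving_snd.ae hν] with p h1 h2
  rw [Real.mul_rpow h1.1 h2.1, ENNReal.ofReal_mul (Real.rpow_nonneg h1.1 _)]

theorem ae_mconv {μ ν : Measure ℝ} [SFinite μ] [SFinite ν]
    (hμ : ∀ᵐ t ∂μ, t ∈ Icc (0 : ℝ) 1) (hν : ∀ᵐ t ∂ν, t ∈ Icc (0 : ℝ) 1) :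
    ∀ᵐ t ∂(μ.mconv ν), t ∈ Icc (0 : ℝ) 1 := by
  refine (ae_map_iff (by fun_prop) measurableSet_Icc).2 ?_
  filter_upwards [Measure.quasiMeasurePreserving_fst.ae hμ,
    Measure.quasiMeasurePreserving_snd.ae hν] with p h1 h2
  exact ⟨mul_nonneg h1.1 h2.1, mul_le_one₀ h1.2 h2.1 h2.2⟩

theorem integrable_of_continuous_of_ae_mem_Icc {μ : Measure ℝ} [IsFiniteMeasure μ]
    (hμ : ∀ᵐ t ∂μ, t ∈ Icc (0 : ℝ) 1) {f : ℝ → ℝ} (hf : Continuous f) : Integrable f μ := by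
  rw [← Measure.restrict_eq_self_of_ae_mem hμ]
  exact hf.continuousOn.integrableOn_compact isCompact_Icc

/-- Probability measures on `[0, 1]` are determined by their moments. -/
theorem ext_of_integral_pow_eq {μ ν : Measure ℝ} [IsProbabilityMeasure μ] [IsProbabilityMeasure ν]
    (hμ : ∀ᵐ t ∂μ, t ∈ Icc (0 : ℝ) 1) (hν : ∀ᵐ t ∂ν, t ∈ Icc (0 : ℝ) 1)
    (h : ∀ n : ℕ, ∫ t, t ^ n ∂μ = ∫ t, t ^ n ∂ν) : μ = ν := by
  have hpoly : ∀ p : Polynomial ℝ, ∫ t, p.eval t ∂μ = ∫ t, p.eval t ∂ν := by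
    intro p
    simp only [Polynomial.eval_eq_sum_range]
    rw [integral_finsetSum _ fun i _ => integrable_of_continuous_of_ae_mem_Icc hμ (by fun_prop),
      integral_finsetSum _ fun i _ => integrable_of_continuous_of_ae_mem_Icc hν (by fun_prop)]
    simp only [integral_const_mul, h]
  have happrox : ∀ (ρ : Measure ℝ) [IsProbabilityMeasure ρ], (∀ᵐ t ∂ρ, t ∈ Icc (0 : ℝ) 1) →
      ∀ (f : BoundedContinuousFunction ℝ ℝ) (p : Polynomial ℝ) (ε : ℝ),
      (∀ x ∈ Icc (0 : ℝ) 1, |p.eval x - f x| < ε) →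
        |∫ t, p.eval t ∂ρ - ∫ t, f t ∂ρ| ≤ ε := by
    intro ρ _ hρ f p ε hp
    rw [← integral_sub (integrable_of_continuous_of_ae_mem_Icc hρ (by fun_prop))
      (integrable_of_continuous_of_ae_mem_Icc hρ f.continuous)]
    have := norm_integral_le_of_norm_le_const (μ := ρ) (f := fun t => p.eval t - f t) (C := ε)
      (by filter_upwards [hρ] with t ht using (hp t ht).le)
    simpa using this
  refine ext_of_forall_integral_eq_of_IsFiniteMeasure fun f => ?_
  refine eq_of_forall_dist_le fun ε hε => ?_
  obtain ⟨p, hp⟩ := exists_polynomial_near_of_continuousOn 0 1 f f.continuous.continuousOn (ε / 2)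
    (by positivity)
  have h1 := abs_le.1 (happrox μ hμ f p _ hp)
  have h2 := abs_le.1 (happrox ν hν f p _ hp)
  rw [hpoly] at h1
  rw [Real.dist_eq, abs_le]
  constructor <;> linarith [h1.1, h1.2, h2.1, h2.2]

theorem toReal_lmellin {μ : Measure ℝ} (hμ : ∀ᵐ t ∂μ, t ∈ Icc (0 : ℝ) 1) (s : ℝ) :
    (lmellin μ s).toReal = ∫ t, t ^ s ∂μ := by
  rw [lmellin, integral_eq_lintegral_of_nonneg_ae _ (by fun_prop)]
  filter_upwards [hμ] with t ht using Real.rpow_nonneg ht.1 s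

theorem lmellin_natCast {μ : Measure ℝ} [IsFiniteMeasure μ]
    (hμ : ∀ᵐ t ∂μ, t ∈ Icc (0 : ℝ) 1) (n : ℕ) :
    lmellin μ n = ENNReal.ofReal (∫ t, t ^ n ∂μ) := by
  simp only [lmellin, Real.rpow_natCast]
  rw [ofReal_integral_eq_lintegral_ofReal
    (integrable_of_continuous_of_ae_mem_Icc hμ (by fun_prop))]
  filter_upwards [hμ] with t ht using pow_nonneg ht.1 n

/-- Hölder's inequality for the Mellin transform. -/
theorem lmellin_convexComb_le {μ : Measure ℝ} (hμ : ∀ᵐ t ∂μ, 0 < t) (x y : ℝ)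
    {a b : ℝ} (ha : 0 ≤ a) (hb : 0 ≤ b) (hab : a + b = 1) :
    lmellin μ (a * x + b * y) ≤ lmellin μ x ^ a * lmellin μ y ^ b := by
  have h := ENNReal.lintegral_mul_norm_pow_le (μ := μ) (f := fun t => ENNReal.ofReal (t ^ x))
    (g := fun t => ENNReal.ofReal (t ^ y)) (by fun_prop) (by fun_prop) ha hb hab
  refine le_trans (le_of_eq (lintegral_congr_ae ?_)) h
  filter_upwards [hμ] with t ht
  rw [ENNReal.ofReal_rpow_of_nonneg (by positivity) ha,
    ENNReal.ofReal_rpow_of_nonneg (by positivity) hb, ← ENNReal.ofReal_mul (by positivity),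
    ← Real.rpow_mul ht.le, ← Real.rpow_mul ht.le, ← Real.rpow_add ht, mul_comm x, mul_comm y]

section FixedPoint

variable {μ : Measure ℝ} [IsProbabilityMeasure μ]

theorem lmellin_segmentLaw_natCast (hμ : ∀ᵐ t ∂μ, t ∈ Icc (0 : ℝ) 1)
    (hmom : ∀ n : ℕ, ∫ t, t ^ n ∂μ = fpSeq n) (n : ℕ) :
    ENNReal.ofReal (n + 1) * lmellin (segmentLaw μ) n = ENNReal.ofReal (1 / fpSeq n) := by
  induction n with
  | zero => simp [lmellin, fpSeq]
  | succ n ih =>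
    have h := lmellin_segmentLaw_add_one hμ (s := n) (by linarith [(Nat.cast_nonneg n : (0:ℝ) ≤ n)])
    have hn := lmellin_natCast hμ (n + 1)
    rw [hmom] at hn
    push_cast at hn ⊢
    rw [add_assoc, one_add_one_eq_two, h, ih, hn,
      ← ENNReal.ofReal_add (one_div_pos.2 (fpSeq_pos n)).le (fpSeq_pos _).le,
      ← one_div_fpSeq_succ]

theorem mconv_segmentLaw (hμ : ∀ᵐ t ∂μ, t ∈ Icc (0 : ℝ) 1)
    (hmom : ∀ n : ℕ, ∫ t, t ^ n ∂μ = fpSeq n) : μ.mconv (segmentLaw μ) = unitVolume := by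
  refine ext_of_integral_pow_eq (ae_mconv hμ (ae_segmentLaw hμ)) ae_unitVolume fun n => ?_
  have hn : (0 : ℝ) < n + 1 := by positivity
  have key : ENNReal.ofReal (n + 1) * lmellin (μ.mconv (segmentLaw μ)) n =
      ENNReal.ofReal (n + 1) * lmellin unitVolume n := by
    rw [lmellin_mconv hμ (ae_segmentLaw hμ), mul_left_comm, lmellin_segmentLaw_natCast hμ hmom,
      lmellin_natCast hμ, hmom, lmellin_unitVolume (by linarith),
      ← ENNReal.ofReal_mul (fpSeq_pos n).le, ← ENNReal.ofReal_mul hn.le,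
      mul_one_div_cancel (fpSeq_pos n).ne', mul_one_div_cancel hn.ne']
  have key' := (ENNReal.mul_right_inj (by simpa using hn) (by simp)).1 key
  have := congrArg ENNReal.toReal key'
  rw [toReal_lmellin (ae_mconv hμ (ae_segmentLaw hμ)), toReal_lmellin ae_unitVolume] at this
  simpa using this

theorem lmellin_mul_lmellin_segmentLaw (hμ : ∀ᵐ t ∂μ, t ∈ Icc (0 : ℝ) 1)
    (hmom : ∀ n : ℕ, ∫ t, t ^ n ∂μ = fpSeq n) {s : ℝ} (hs : -1 < s) :
    lmellin μ s * (ENNReal.ofReal (s + 1) * lmellin (segmentLaw μ) s) = 1 := by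
  have hs' : 0 < s + 1 := by linarith
  rw [mul_left_comm, ← lmellin_mconv hμ (ae_segmentLaw hμ), mconv_segmentLaw hμ hmom,
    lmellin_unitVolume hs, ← ENNReal.ofReal_mul hs'.le, mul_one_div_cancel hs'.ne',
    ENNReal.ofReal_one]

theorem lmellin_ne_zero (hμ : ∀ᵐ t ∂μ, t ∈ Icc (0 : ℝ) 1)
    (hmom : ∀ n : ℕ, ∫ t, t ^ n ∂μ = fpSeq n) {s : ℝ} (hs : -1 < s) : lmellin μ s ≠ 0 :=
  left_ne_zero_of_mul_eq_one (lmellin_mul_lmellin_segmentLaw hμ hmom hs)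

theorem lmellin_ne_top (hμ : ∀ᵐ t ∂μ, t ∈ Icc (0 : ℝ) 1)
    (hmom : ∀ n : ℕ, ∫ t, t ^ n ∂μ = fpSeq n) {s : ℝ} (hs : -1 < s) : lmellin μ s ≠ ⊤ := by
  intro h
  have h1 := lmellin_mul_lmellin_segmentLaw hμ hmom hs
  rw [h, ENNReal.top_mul (right_ne_zero_of_mul_eq_one h1)] at h1
  simp at h1

theorem lmellin_inv (hμ : ∀ᵐ t ∂μ, t ∈ Icc (0 : ℝ) 1)
    (hmom : ∀ n : ℕ, ∫ t, t ^ n ∂μ = fpSeq n) {s : ℝ} (hs : -1 < s) :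
    (lmellin μ s)⁻¹ = ENNReal.ofReal (s + 1) * lmellin (segmentLaw μ) s :=
  (ENNReal.eq_inv_of_mul_eq_one_left
    (mul_comm (lmellin μ s) _ ▸ lmellin_mul_lmellin_segmentLaw hμ hmom hs)).symm

theorem lmellin_inv_add_one (hμ : ∀ᵐ t ∂μ, t ∈ Icc (0 : ℝ) 1)
    (hmom : ∀ n : ℕ, ∫ t, t ^ n ∂μ = fpSeq n) {s : ℝ} (hs : -1 < s) :
    (lmellin μ (s + 1))⁻¹ = (lmellin μ s)⁻¹ + lmellin μ (s + 1) := by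
  rw [lmellin_inv hμ hmom hs, lmellin_inv hμ hmom (by linarith),
    ← lmellin_segmentLaw_add_one hμ hs, add_assoc, one_add_one_eq_two]

theorem isLogConvexSolution_toReal_lmellin (hμ : ∀ᵐ t ∂μ, t ∈ Icc (0 : ℝ) 1) (h0 : μ {0} = 0)
    (hmom : ∀ n : ℕ, ∫ t, t ^ n ∂μ = fpSeq n) :
    IsLogConvexSolution fun s => (lmellin μ s).toReal := by
  have hpos : ∀ s : ℝ, -1 < s → 0 < (lmellin μ s).toReal := fun s hs =>
    ENNReal.toReal_pos (lmellin_ne_zero hμ hmom hs) (lmellin_ne_top hμ hmom hs)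
  refine ⟨hpos, by simp [lmellin], ⟨convex_Ioi _, ?_⟩, fun s hs => ?_⟩
  · intro x hx y hy a b ha hb hab
    have hμ' : ∀ᵐ t ∂μ, 0 < t := by
      have h0' : ∀ᵐ t ∂μ, t ≠ 0 := by simpa [ae_iff] using h0
      filter_upwards [hμ, h0'] with t ht ht' using lt_of_le_of_ne ht.1 (Ne.symm ht')
    have hxy := (convex_Ioi (-1 : ℝ)) hx hy ha hb hab
    have h := ENNReal.toReal_mono
      (ENNReal.mul_ne_top (ENNReal.rpow_ne_top_of_nonneg ha (lmellin_ne_top hμ hmom hx))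
        (ENNReal.rpow_ne_top_of_nonneg hb (lmellin_ne_top hμ hmom hy)))
      (lmellin_convexComb_le hμ' x y ha hb hab)
    rw [ENNReal.toReal_mul, ← ENNReal.toReal_rpow, ← ENNReal.toReal_rpow] at h
    have px := hpos x hx
    have py := hpos y hy
    have h' := Real.log_le_log (hpos _ hxy) h
    rwa [Real.log_mul (by positivity) (by positivity), Real.log_rpow px, Real.log_rpow py] at h'
  · have h := congrArg ENNReal.toReal (lmellin_inv_add_one hμ hmom hs)
    rw [ENNReal.toReal_add (ENNReal.inv_ne_top.2 (lmellin_ne_zero hμ hmom hs))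
      (lmellin_ne_top hμ hmom (by linarith)), ENNReal.toReal_inv, ENNReal.toReal_inv] at h
    simp only [one_div]
    linarith

end FixedPoint

theorem stmt_6 (μ : Measure ℝ) [IsProbabilityMeasure μ]
    (hsupp : μ (Set.Icc (0:ℝ) 1)ᶜ = 0) (h0 : μ {0} = 0)
    (hmom : ∀ n : ℕ, ∫ t in Set.Icc (0:ℝ) 1, t ^ n ∂μ = fpSeq n) :
    ((∀ s : ℝ, -1 < s → 0 < mellinReal μ s) ∧
      mellinReal μ 0 = 1 ∧
      ConvexOn ℝ (Set.Ioi (-1:ℝ)) (fun s => Real.log (mellinReal μ s)) ∧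
      (∀ s : ℝ, -1 < s →
        1 / mellinReal μ s = 1 / mellinReal μ (s + 1) - mellinReal μ (s + 1))) ∧
    ∀ G : ℝ → ℝ, (∀ s : ℝ, -1 < s → 0 < G s) → G 0 = 1 →
      ConvexOn ℝ (Set.Ioi (-1:ℝ)) (fun s => Real.log (G s)) →
      (∀ s : ℝ, -1 < s → 1 / G s = 1 / G (s + 1) - G (s + 1)) →
      ∀ s : ℝ, -1 < s → G s = mellinReal μ s := by
  have hμ : ∀ᵐ t ∂μ, t ∈ Icc (0 : ℝ) 1 := hsupp
  rw [Measure.restrict_eq_self_of_ae_mem hμ] at hmom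
  have hmellin : mellinReal μ = fun s => (lmellin μ s).toReal := by
    funext s
    rw [mellinReal, Measure.restrict_eq_self_of_ae_mem hμ, toReal_lmellin hμ]
  have hF : IsLogConvexSolution (mellinReal μ) :=
    hmellin ▸ isLogConvexSolution_toReal_lmellin hμ h0 hmom
  exact ⟨⟨hF.pos, hF.map_zero, hF.logConvex, hF.recurrence⟩,
    fun G h1 h2 h3 h4 s hs => IsLogConvexSolution.eq ⟨h1, h2, h3, h4⟩ hF hs⟩
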